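/- Every 4-critical graph on n vertices has at least (5n − 2)/3 edges. -/

import Mathlib

universe u
variable {V : Type u}

/-- A graph is 4-critical if its chromatic number is 4 and every proper subgraph
is 3-colorable. -/
def SimpleGraph.IsFourCritical (G : SimpleGraph V) : Prop :=
  G.chromaticNumber = 4 ∧ ∀ H : G.Subgraph, H ≠ ⊤ → H.coe.Colorable 3

namespace SimpleGraph

section

open scoped Classical

/-- The number of ordered pairs `(u, v) ∈ S × T` of adjacent vertices. -/
noncomputable def adjPairs (G : SimpleGraph V) (S T : Finset V) : ℤ :=
  ∑ u ∈ S, ∑ v ∈ T, if G.Adj u v then 1 else 0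

/-- Twice the Kostochka–Yancey potential `5 |S| - 3 |E(G[S])|`. -/
noncomputable def potential (G : SimpleGraph V) (S : Finset V) : ℤ :=
  10 * (S.card : ℤ) - 3 * G.adjPairs S S

/-- The subgraph of `G` induced on `S` is 3-colorable. -/
def ThreeColorableOn (G : SimpleGraph V) (S : Finset V) : Prop :=
  ∃ c : V → Fin 3, ∀ u ∈ S, ∀ v ∈ S, G.Adj u v → c u ≠ c v

/-- `G` is not 3-colorable, but all its proper induced subgraphs are. -/
def IsVertexFourCritical [Fintype V] (G : SimpleGraph V) : Prop :=
  ¬ G.ThreeColorableOn Finset.univ ∧ ∀ S, S ≠ Finset.univ → G.ThreeColorableOn S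

variable {G H : SimpleGraph V} {S T S' T' : Finset V}

theorem adjPairs_comm : G.adjPairs S T = G.adjPairs T S := by
  unfold adjPairs
  rw [Finset.sum_comm]
  simp only [G.adj_comm]

theorem adjPairs_nonneg : 0 ≤ G.adjPairs S T :=
  Finset.sum_nonneg fun _ _ => Finset.sum_nonneg fun _ _ => by split_ifs <;> simp

theorem adjPairs_union_left (h : Disjoint S S') :
    G.adjPairs (S ∪ S') T = G.adjPairs S T + G.adjPairs S' T :=
  Finset.sum_union h

theorem adjPairs_union_right (h : Disjoint T T') :
    G.adjPairs S (T ∪ T') = G.adjPairs S T + G.adjPairs S T' := by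
  rw [adjPairs_comm, adjPairs_union_left h, adjPairs_comm, adjPairs_comm (S := T')]

theorem adjPairs_union_self (h : Disjoint S T) :
    G.adjPairs (S ∪ T) (S ∪ T) =
      G.adjPairs S S + 2 * G.adjPairs S T + G.adjPairs T T := by
  rw [adjPairs_union_left h, adjPairs_union_right h, adjPairs_union_right h,
    adjPairs_comm (S := T) (T := S)]
  ring

theorem adjPairs_congr (h : ∀ u ∈ S, ∀ v ∈ T, (G.Adj u v ↔ H.Adj u v)) :
    G.adjPairs S T = H.adjPairs S T :=
  Finset.sum_congr rfl fun u hu => Finset.sum_congr rfl fun v hv => by simp only [h u hu v hv]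

theorem adjPairs_mono_left (h : S ⊆ S') : G.adjPairs S T ≤ G.adjPairs S' T :=
  Finset.sum_le_sum_of_subset_of_nonneg h fun _ _ _ =>
    Finset.sum_nonneg fun _ _ => by split_ifs <;> simp

theorem adjPairs_mono_right (h : T ⊆ T') : G.adjPairs S T ≤ G.adjPairs S T' := by
  rw [adjPairs_comm, adjPairs_comm (T := T')]
  exact adjPairs_mono_left h

theorem adjPairs_singleton_left (u : V) :
    G.adjPairs {u} T = ((T.filter (G.Adj u)).card : ℤ) := by
  simp [adjPairs]

theorem adjPairs_eq_sum_card :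
    G.adjPairs S T = ∑ u ∈ S, ((T.filter (G.Adj u)).card : ℤ) := by
  simp [adjPairs]

theorem one_le_adjPairs {u v : V} (hu : u ∈ S) (hv : v ∈ T) (h : G.Adj u v) :
    1 ≤ G.adjPairs S T := by
  have h1 : G.adjPairs {u} {v} = 1 := by simp [adjPairs, Finset.filter_singleton, h]
  rw [← h1]
  exact (adjPairs_mono_left (by simpa using hu)).trans (adjPairs_mono_right (by simpa using hv))

theorem even_adjPairs_self (G : SimpleGraph V) (S : Finset V) : Even (G.adjPairs S S) := by
  induction S using Finset.induction_on with
  | empty => simp [adjPairs]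
  | insert v S hv ih =>
    rw [Finset.insert_eq, adjPairs_union_self (by simpa using hv)]
    have : G.adjPairs {v} {v} = 0 := by simp [adjPairs]
    rw [this, zero_add]
    exact (even_two_mul _).add ih

theorem even_potential (G : SimpleGraph V) (S : Finset V) : Even (G.potential S) := by
  obtain ⟨k, hk⟩ := G.even_adjPairs_self S
  exact ⟨5 * S.card - 3 * k, by unfold potential; rw [hk]; ring⟩

theorem ThreeColorableOn.mono (h : G.ThreeColorableOn T) (hST : S ⊆ T) : G.ThreeColorableOn S :=
  h.imp fun _ hc u hu v hv => hc u (hST hu) v (hST hv)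

theorem ThreeColorableOn.congr (h : G.ThreeColorableOn S)
    (hGH : ∀ u ∈ S, ∀ v ∈ S, H.Adj u v → G.Adj u v) : H.ThreeColorableOn S :=
  h.imp fun _ hc u hu v hv huv => hc u hu v hv (hGH u hu v hv huv)

theorem four_le_card_of_not_threeColorableOn (h : ¬ G.ThreeColorableOn S) : 4 ≤ S.card := by
  by_contra! hS
  obtain ⟨f⟩ : Nonempty (S ↪ Fin 3) :=
    Function.Embedding.nonempty_of_card_le (by simp; omega)
  refine h ⟨fun v => if hv : v ∈ S then f ⟨v, hv⟩ else 0, fun u hu v hv huv hc => huv.ne ?_⟩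
  simpa [hu, hv] using hc

/-- A color class can be chosen outside a set of at most two colors. -/
theorem exists_color_not_mem {A : Finset V} (hA : A.card ≤ 2) (c : V → Fin 3) :
    ∃ i, ∀ v ∈ A, c v ≠ i := by
  by_contra! h
  have : (Finset.univ : Finset (Fin 3)) ⊆ A.image c := fun i _ => by
    simpa using h i
  have := (Finset.card_le_card this).trans Finset.card_image_le
  simp at this
  omega

/-- The graph obtained from `G` by making `R` a clique and redirecting every edge between
`a ∉ R` and `w ∈ R` to the vertex `g w`. -/
theorem exists_collapse (G : SimpleGraph V) (R : Finset V) (g : V → V) :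
    ∃ H : SimpleGraph V, (∀ a ∉ R, ∀ b ∉ R, (H.Adj a b ↔ G.Adj a b)) ∧
      (∀ a ∉ R, ∀ b ∈ R, (H.Adj a b ↔ ∃ w ∈ R, g w = b ∧ G.Adj a w)) ∧
      (∀ a ∈ R, ∀ b ∈ R, (H.Adj a b ↔ a ≠ b)) := by
  refine ⟨SimpleGraph.fromRel fun a b =>
    (a ∉ R ∧ b ∉ R ∧ G.Adj a b) ∨ (a ∈ R ∧ b ∈ R) ∨
      (a ∉ R ∧ b ∈ R ∧ ∃ w ∈ R, g w = b ∧ G.Adj a w), ?_, ?_, ?_⟩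
  · intro a ha b hb
    have h : G.Adj a b → a ≠ b := fun h => h.ne
    simpa [ha, hb, G.adj_comm b a] using h
  · intro a ha b hb
    have : a ≠ b := fun h => ha (h ▸ hb)
    simp [ha, hb, this]
  · intro a ha b hb
    simp [ha, hb]

/-- The graph obtained from `G` by adding to `u` all the neighbors of `v`. -/
theorem exists_merge (G : SimpleGraph V) (u v : V) :
    ∃ H : SimpleGraph V, (∀ a ≠ u, ∀ b ≠ u, (H.Adj a b ↔ G.Adj a b)) ∧
      ∀ b ≠ u, (H.Adj u b ↔ G.Adj u b ∨ G.Adj v b) := by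
  refine ⟨SimpleGraph.fromRel fun a b => G.Adj a b ∨ (a = u ∧ G.Adj v b), ?_, ?_⟩
  · intro a ha b hb
    have h : G.Adj a b → a ≠ b := fun h => h.ne
    simpa [ha, hb, G.adj_comm b a] using h
  · intro b hb
    simp only [fromRel_adj, hb, false_and, or_false, true_and, G.adj_comm b u]
    have := hb.symm
    tauto

variable [Fintype V]

theorem IsVertexFourCritical.three_le_degree (hG : G.IsVertexFourCritical) (v : V) :
    3 ≤ (Finset.univ.filter (G.Adj v)).card := by
  by_contra! hv
  obtain ⟨c, hc⟩ := hG.2 (Finset.univ.erase v) (by simp [Finset.ext_iff])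
  obtain ⟨i, hi⟩ := exists_color_not_mem (A := Finset.univ.filter (G.Adj v)) (by omega) c
  refine hG.1 ⟨Function.update c v i, fun u _ w _ huw => ?_⟩
  by_cases h1 : u = v
  · subst h1
    simpa [huw.ne'] using (hi w (by simpa using huw)).symm
  · by_cases h2 : w = v
    · subst h2
      simpa [huw.ne] using (hi u (by simpa using huw.symm))
    · simpa [h1, h2] using hc u (by simpa using h1) w (by simpa using h2) huw

/-- Every non-3-colorable graph with fewer vertices than `V` has a set of small potential
witnessing this; this is the induction hypothesis of the main argument. -/
def SmallerWitness (V : Type u) [Fintype V] : Prop :=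
  ∀ (H : SimpleGraph V) (T : Finset V), T.card < Fintype.card V → ¬ H.ThreeColorableOn T →
    ∃ S ⊆ T, ¬ H.ThreeColorableOn S ∧ H.potential S ≤ 4

/-- Identifying each color class of a proper 3-coloring of `R` with a vertex of a triangle. -/
theorem exists_potential_union_le (hV : SmallerWitness V) (hG : G.IsVertexFourCritical)
    {R : Finset V} (hR : 4 ≤ R.card) {φ : V → Fin 3}
    (hφ : ∀ u ∈ R, ∀ v ∈ R, G.Adj u v → φ u ≠ φ v) :
    ∃ S ⊆ Rᶜ, ∃ X : Finset (Fin 3), X.Nonempty ∧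
      G.potential (S ∪ R) + 6 * G.adjPairs S (R.filter (φ · ∉ X)) ≤
        4 - (10 * X.card - 3 * (X.card * (X.card - 1))) + G.potential R := by
  obtain ⟨f⟩ : Nonempty (Fin 3 ↪ R) :=
    Function.Embedding.nonempty_of_card_le (by simp; omega)
  let r : Fin 3 ↪ V := f.trans (Function.Embedding.subtype _)
  have hr : ∀ i, r i ∈ R := fun i => (f i).2
  obtain ⟨H, hHo, hHm, hHi⟩ := G.exists_collapse R (fun w => r (φ w))
  let P : Finset V := Finset.univ.map r
  have hrP : ∀ i, r i ∈ P := fun i => Finset.mem_map_of_mem _ (Finset.mem_univ i)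
  obtain ⟨S, hST, hS, hpot⟩ := hV H (Rᶜ ∪ P) (by
      have h1 := Finset.card_union_le Rᶜ P
      have h2 : P.card = 3 := by simp [P]
      have h3 := Finset.card_add_card_compl R
      omega) (by
    rintro ⟨c, hc⟩
    have hinj : ∀ i j, i ≠ j → c (r i) ≠ c (r j) := fun i j hij =>
      hc _ (by simp [hrP]) _ (by simp [hrP])
        ((hHi _ (hr i) _ (hr j)).2 fun h => hij (r.injective h))
    have hmix : ∀ u ∉ R, ∀ w ∈ R, G.Adj u w → c u ≠ c (r (φ w)) := fun u hu w hw huw =>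
      hc _ (by simp [hu]) _ (by simp [hrP]) ((hHm u hu _ (hr _)).2 ⟨w, hw, rfl, huw⟩)
    refine hG.1 ⟨fun v => if v ∈ R then c (r (φ v)) else c v, fun u _ v _ huv => ?_⟩
    by_cases hu : u ∈ R <;> by_cases hv : v ∈ R <;> simp only [hu, hv, if_true, if_false]
    · exact hinj _ _ (hφ u hu v hv huv)
    · exact (hmix v hv u hu huv.symm).symm
    · exact hmix u hu v hv huv
    · exact hc u (by simp [hu]) v (by simp [hv]) ((hHo u hu v hv).2 huv))
  let A : Finset V := S.filter (· ∉ R)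
  let X : Finset (Fin 3) := Finset.univ.filter (r · ∈ S)
  let B : Finset V := X.map r
  have hAR : A ⊆ Rᶜ := fun x hx => by simpa using (Finset.mem_filter.1 hx).2
  have hBR : B ⊆ R := by
    intro x hx
    obtain ⟨i, -, rfl⟩ := Finset.mem_map.1 hx
    exact hr i
  have hAB : Disjoint A B :=
    Finset.disjoint_left.2 fun x hx hx' => (Finset.mem_filter.1 hx).2 (hBR hx')
  have hARd : Disjoint A R :=
    Finset.disjoint_left.2 fun x hx hx' => (Finset.mem_filter.1 hx).2 hx'
  have hSAB : S = A ∪ B := by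
    ext x
    simp only [A, B, X, Finset.mem_union, Finset.mem_filter, Finset.mem_map, Finset.mem_univ,
      true_and]
    constructor
    · intro hx
      by_cases hxR : x ∈ R
      · right
        have := hST hx
        simp only [Finset.mem_union, Finset.mem_compl, hxR, not_true, false_or, P,
          Finset.mem_map, Finset.mem_univ, true_and] at this
        obtain ⟨i, rfl⟩ := this
        exact ⟨i, hx, rfl⟩
      · exact Or.inl ⟨hx, hxR⟩
    · rintro (h | ⟨i, hi, rfl⟩)
      · exact h.1
      · exact hi
  refine ⟨A, hAR, X, ?_, ?_⟩
  · by_contra hX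
    rw [Finset.not_nonempty_iff_eq_empty] at hX
    have hSA : S = A := by rw [hSAB]; simp [B, hX]
    have hne : Rᶜ ≠ Finset.univ := by
      intro h
      have : R = ∅ := by simpa using h
      simp [this] at hR
    refine hS (((hG.2 _ hne).mono (hSA ▸ hAR)).congr fun u hu v hv huv => ?_)
    rw [hSA] at hu hv
    exact (hHo u (Finset.mem_filter.1 hu).2 v (Finset.mem_filter.1 hv).2).1 huv
  · have e1 : H.adjPairs A A = G.adjPairs A A := adjPairs_congr fun u hu v hv =>
      hHo u (Finset.mem_filter.1 hu).2 v (Finset.mem_filter.1 hv).2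
    have e2 : H.adjPairs B B = X.card * (X.card - 1) := by
      rw [adjPairs_eq_sum_card]
      have : ∀ u ∈ B, ((B.filter (H.Adj u)).card : ℤ) = X.card - 1 := by
        intro u hu
        have h1 : B.filter (H.Adj u) = B.erase u := by
          ext v
          simp only [Finset.mem_filter, Finset.mem_erase]
          constructor
          · rintro ⟨hv, huv⟩
            exact ⟨huv.ne', hv⟩
          · rintro ⟨hvu, hv⟩
            exact ⟨hv, (hHi u (hBR hu) v (hBR hv)).2 hvu.symm⟩
        rw [h1, Finset.cast_card_erase_of_mem hu]
        simp [B]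
      rw [Finset.sum_congr rfl this]
      simp only [B, Finset.sum_const, Finset.card_map, nsmul_eq_mul]
    have e3 : H.adjPairs A B ≤ G.adjPairs A (R.filter (φ · ∈ X)) := by
      rw [adjPairs_eq_sum_card, adjPairs_eq_sum_card]
      refine Finset.sum_le_sum fun a ha => ?_
      have haR := (Finset.mem_filter.1 ha).2
      have : B.filter (H.Adj a) ⊆
          ((R.filter (φ · ∈ X)).filter (G.Adj a)).image (fun w => r (φ w)) := by
        intro b hb
        obtain ⟨hb, hab⟩ := Finset.mem_filter.1 hb
        obtain ⟨w, hw, rfl, haw⟩ := (hHm a haR b (hBR hb)).1 hab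
        have : φ w ∈ X := by simpa [B] using hb
        exact Finset.mem_image.2 ⟨w, by simp [hw, this, haw], rfl⟩
      exact_mod_cast (Finset.card_le_card this).trans Finset.card_image_le
    have e4 : G.adjPairs A R =
        G.adjPairs A (R.filter (φ · ∈ X)) + G.adjPairs A (R.filter (φ · ∉ X)) := by
      rw [← adjPairs_union_right (Finset.disjoint_filter_filter_not _ _ _),
        Finset.filter_union_filter_not_eq]
    have e5 : B.card = X.card := by simp [B]
    rw [hSAB] at hpot
    unfold potential at hpot ⊢
    rw [adjPairs_union_self hAB, Finset.card_union_of_disjoint hAB, e1, e2, e5] at hpot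
    rw [adjPairs_union_self hARd, Finset.card_union_of_disjoint hARd, e4]
    push_cast at hpot ⊢
    linarith

/-- The potential of a clique on one, two or three vertices is at least that of a vertex. -/
theorem ten_le_clique_potential {X : Finset (Fin 3)} (hX : X.Nonempty) :
    (10 : ℤ) ≤ 10 * X.card - 3 * (X.card * (X.card - 1)) := by
  have h1 := hX.card_pos
  have h2 : X.card ≤ 3 := by simpa using X.card_le_univ
  interval_cases X.card <;> norm_num

theorem ne_univ_of_not_mem {S : Finset V} {x : V} (hx : x ∉ S) : S ≠ Finset.univ :=
  fun h => hx (h ▸ Finset.mem_univ x)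

theorem twelve_le_potential (hV : SmallerWitness V) (hG : G.IsVertexFourCritical)
    (hp : 6 ≤ G.potential Finset.univ) {R : Finset V} (hR : 4 ≤ R.card)
    (hne : R ≠ Finset.univ) : 12 ≤ G.potential R := by
  obtain ⟨Q, hQ, hmin⟩ := Finset.exists_min_image
    (Finset.univ.filter fun Q : Finset V => 4 ≤ Q.card ∧ Q ≠ Finset.univ) G.potential
    ⟨R, by simp [hR, hne]⟩
  simp only [Finset.mem_filter, Finset.mem_univ, true_and] at hQ hmin
  refine le_trans ?_ (hmin R ⟨hR, hne⟩)
  obtain ⟨φ, hφ⟩ := hG.2 Q hQ.2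
  obtain ⟨S, -, X, hX, h⟩ := exists_potential_union_le hV hG hQ.1 hφ
  have h1 := ten_le_clique_potential hX
  have h2 : 0 ≤ G.adjPairs S (Q.filter (φ · ∉ X)) := adjPairs_nonneg
  by_cases hu : S ∪ Q = Finset.univ
  · rw [hu] at h
    linarith
  · have := hmin (S ∪ Q)
      ⟨hQ.1.trans (Finset.card_le_card Finset.subset_union_right), hu⟩
    linarith

/-- A proper vertex set has a 3-coloring distinguishing any two given vertices. -/
theorem exists_coloring_ne (hV : SmallerWitness V) (hG : G.IsVertexFourCritical)
    (hp : 6 ≤ G.potential Finset.univ) {R : Finset V} (hne : R ≠ Finset.univ) {a b : V}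
    (ha : a ∈ R) (hb : b ∈ R) (hab : a ≠ b) :
    ∃ c : V → Fin 3, (∀ u ∈ R, ∀ v ∈ R, G.Adj u v → c u ≠ c v) ∧ c a ≠ c b := by
  let H : SimpleGraph V := G ⊔ edge a b
  have hHab : H.Adj a b := by simp [H, edge_adj, hab]
  suffices H.ThreeColorableOn R by
    obtain ⟨c, hc⟩ := this
    exact ⟨c, fun u hu v hv huv => hc u hu v hv (Or.inl huv), hc a ha b hb hHab⟩
  by_contra hR
  obtain ⟨S, hSR, hS, hpot⟩ := hV H R ((Finset.card_lt_iff_ne_univ R).2 hne) hR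
  have hS4 := four_le_card_of_not_threeColorableOn hS
  have hSne : S ≠ Finset.univ := fun h => hne (Finset.univ_subset_iff.1 (h ▸ hSR))
  have h12 := twelve_le_potential hV hG hp hS4 hSne
  have key : H.adjPairs S S ≤ G.adjPairs S S + 2 := by
    have h1 : H.adjPairs S S ≤ G.adjPairs S S + ∑ u ∈ S, ∑ v ∈ S,
        ((if u = a then (if v = b then 1 else 0) else 0) +
          (if u = b then (if v = a then 1 else 0) else 0) : ℤ) := by
      unfold adjPairs
      rw [← Finset.sum_add_distrib]
      refine Finset.sum_le_sum fun u _ => ?_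
      rw [← Finset.sum_add_distrib]
      refine Finset.sum_le_sum fun v _ => ?_
      simp only [H, sup_adj, edge_adj]
      split_ifs <;> first | omega | (exfalso; tauto)
    have h2 : ∀ x y : V, ∑ u ∈ S, ∑ v ∈ S,
        (if u = x then (if v = y then 1 else 0) else 0 : ℤ) ≤ 1 := by
      intro x y
      by_cases hx : x ∈ S <;> by_cases hy : y ∈ S <;>
        simp [hx, hy]
    simp only [Finset.sum_add_distrib] at h1
    linarith [h2 a b, h2 b a]
  unfold potential at hpot h12
  linarith

/-- There is no cut vertex. -/
theorem IsVertexFourCritical.exists_boundary (hG : G.IsVertexFourCritical) {R : Finset V}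
    (hR : 2 ≤ R.card) (hne : R ≠ Finset.univ) {u : V} (hu : u ∈ R) :
    ∃ u' ∈ R, u' ≠ u ∧ ∃ w ∉ R, G.Adj u' w := by
  by_contra! hcut
  obtain ⟨x, hx, hxu⟩ := Finset.exists_mem_ne hR u
  obtain ⟨c, hc⟩ := hG.2 R hne
  obtain ⟨d, hd⟩ := hG.2 (insert u Rᶜ) (ne_univ_of_not_mem (x := x) (by simp [hx, hxu]))
  let e : V → Fin 3 := fun v => Equiv.swap (c u) (d u) (d v)
  have heu : e u = c u := by simp [e]
  have he : ∀ v ∈ insert u Rᶜ, ∀ w ∈ insert u Rᶜ, G.Adj v w → e v ≠ e w :=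
    fun v hv w hw hvw h => hd v hv w hw hvw ((Equiv.swap _ _).injective h)
  have hmix : ∀ v ∈ R, ∀ w ∉ R, G.Adj v w → c v ≠ e w := by
    intro v hv w hw hvw
    by_cases hvu : v = u
    · subst hvu
      rw [← heu]
      exact he v (by simp) w (by simp [hw]) hvw
    · exact (hcut v hv hvu w hw hvw).elim
  refine hG.1 ⟨fun v => if v ∈ R then c v else e v, fun v _ w _ hvw => ?_⟩
  by_cases hv : v ∈ R <;> by_cases hw : w ∈ R <;> simp only [hv, hw, if_true, if_false]
  · exact hc v hv w hw hvw
  · exact hmix v hv w hw hvw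
  · exact (hmix w hw v hv hvw.symm).symm
  · exact he v (by simp [hv]) w (by simp [hw]) hvw

theorem twelve_lt_potential (hV : SmallerWitness V) (hG : G.IsVertexFourCritical)
    (hp : 6 ≤ G.potential Finset.univ) {R : Finset V} (hR : 4 ≤ R.card)
    (hne : R ≠ Finset.univ) : 12 < G.potential R := by
  by_contra! h12
  obtain ⟨x, hx⟩ : R.Nonempty := Finset.card_pos.1 (by omega)
  obtain ⟨a, ha, -, a', ha', haa'⟩ := hG.exists_boundary (by omega) hne hx
  obtain ⟨b, hb, hba, b', hb', hbb'⟩ := hG.exists_boundary (by omega) hne ha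
  obtain ⟨φ, hφ, hφab⟩ := exists_coloring_ne hV hG hp hne ha hb hba.symm
  obtain ⟨S, -, X, hX, h⟩ := exists_potential_union_le hV hG hR hφ
  have h1 := ten_le_clique_potential hX
  have h2 : 0 ≤ G.adjPairs S (R.filter (φ · ∉ X)) := adjPairs_nonneg
  by_cases hu : S ∪ R = Finset.univ
  · rw [hu] at h
    have hcard := hX.card_pos
    have hX3 : X.card ≤ 3 := by simpa using X.card_le_univ
    by_cases hX1 : X.card = 1
    · obtain ⟨i, rfl⟩ := Finset.card_eq_one.1 hX1
      have hS : ∀ w ∉ R, w ∈ S := fun w hw => by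
        have := Finset.mem_univ w
        rw [← hu] at this
        simpa [hw] using this
      have h3 : 1 ≤ G.adjPairs S (R.filter (φ · ∉ ({i} : Finset (Fin 3)))) := by
        by_cases hai : φ a = i
        · exact one_le_adjPairs (hS b' hb')
            (by simpa [hb] using fun h => hφab (hai.trans h.symm)) hbb'.symm
        · exact one_le_adjPairs (hS a' ha') (by simp [ha, hai]) haa'.symm
      linarith
    · have : (12 : ℤ) ≤ 10 * X.card - 3 * (X.card * (X.card - 1)) := by
        interval_cases X.card <;> simp at hX1 ⊢
      linarith
  · have := twelve_le_potential hV hG hp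
      (hR.trans (Finset.card_le_card (Finset.subset_union_right (s₁ := S)))) hu
    linarith

/-- Two adjacent vertices of degree three have no common neighbor. -/
theorem false_of_triangle (hV : SmallerWitness V) (hG : G.IsVertexFourCritical)
    (hp : 6 ≤ G.potential Finset.univ) {x y z : V} (hxy : G.Adj x y) (hxz : G.Adj x z)
    (hyz : G.Adj y z) (hx : (Finset.univ.filter (G.Adj x)).card = 3)
    (hy : (Finset.univ.filter (G.Adj y)).card = 3) : False := by
  have third : ∀ p q : V, G.Adj p q → G.Adj p z → q ≠ z →
      (Finset.univ.filter (G.Adj p)).card = 3 →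
      ∃ a, a ≠ q ∧ a ≠ z ∧ ∀ w, G.Adj p w ↔ w = q ∨ w = z ∨ w = a := by
    intro p q hpq hpz hqz hcard
    have : (((Finset.univ.filter (G.Adj p)).erase q).erase z).card = 1 := by
      rw [Finset.card_erase_of_mem (by simp [hpz, hqz.symm]),
        Finset.card_erase_of_mem (by simp [hpq]), hcard]
    obtain ⟨a, ha⟩ := Finset.card_eq_one.1 this
    have hw : ∀ w, w ≠ z ∧ w ≠ q ∧ G.Adj p w ↔ w = a := fun w => by
      simpa using Finset.ext_iff.1 ha w
    have haa := (hw a).2 rfl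
    refine ⟨a, haa.2.1, haa.1, fun w => ⟨fun h => ?_, ?_⟩⟩
    · have := hw w
      tauto
    · rintro (rfl | rfl | rfl)
      exacts [hpq, hpz, haa.2.2]
  obtain ⟨a, hay, haz, hNx⟩ := third x y hxy hxz hyz.ne hx
  obtain ⟨b, hbx, hbz, hNy⟩ := third y x hxy.symm hyz hxz.ne hy
  have hxa : G.Adj x a := (hNx a).2 (by simp)
  have hyb : G.Adj y b := (hNy b).2 (by simp)
  by_cases hab : a = b
  · subst hab
    have h1 : G.adjPairs {z, a} {z, a} ≥ 0 := adjPairs_nonneg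
    have hd : Disjoint ({x, y} : Finset V) {z, a} := by
      simp [hxz.ne', hyz.ne', hxa.ne', hyb.ne']
    have hc4 : (({x, y} : Finset V) ∪ {z, a}).card = 4 := by
      rw [Finset.card_union_of_disjoint hd, Finset.card_pair hxy.ne, Finset.card_pair haz.symm]
    have h2 : G.adjPairs {x, y} {x, y} = 2 := by
      simp [adjPairs, Finset.sum_pair hxy.ne, hxy, hxy.symm]
    have h3 : G.adjPairs {x, y} {z, a} = 4 := by
      simp only [adjPairs, Finset.sum_pair hxy.ne, Finset.sum_pair haz.symm, hxz, hxa, hyz, hyb]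
      norm_num
    have hpot : G.potential ({x, y} ∪ {z, a}) ≤ 10 := by
      unfold potential
      rw [hc4, adjPairs_union_self hd, h2, h3]
      push_cast
      linarith
    by_cases hne : ({x, y} : Finset V) ∪ {z, a} = Finset.univ
    · have hdeg : (12 : ℤ) ≤ G.adjPairs Finset.univ Finset.univ := by
        rw [adjPairs_eq_sum_card]
        have := Finset.card_nsmul_le_sum Finset.univ
          (fun v => ((Finset.univ.filter (G.Adj v)).card : ℤ)) 3
          fun v _ => by exact_mod_cast hG.three_le_degree v
        rw [← hne, hc4, hne] at this
        simpa using this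
      unfold potential at hp
      rw [← hne, hc4, hne] at hp
      push_cast at hp
      linarith
    · linarith [twelve_le_potential hV hG hp hc4.ge hne]
  · have hne : ({x, y} : Finset V)ᶜ ≠ Finset.univ := ne_univ_of_not_mem (x := x) (by simp)
    obtain ⟨c, hc, hcab⟩ := exists_coloring_ne hV hG hp hne (a := a) (b := b)
      (by simp [hay, hxa.ne']) (by simp [hbx, hyb.ne']) hab
    have hcol : ∀ i j k : Fin 3, i ≠ j →
        ∃ p q, p ≠ q ∧ p ≠ i ∧ p ≠ k ∧ q ≠ j ∧ q ≠ k := by decide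
    obtain ⟨p, q, hpq, hpa, hpz, hqb, hqz⟩ := hcol _ _ (c z) hcab
    let d : V → Fin 3 := fun v => if v = x then p else if v = y then q else c v
    have hdx : d x = p := by simp [d]
    have hdy : d y = q := by simp [d, hxy.ne']
    have hdo : ∀ v, v ≠ x → v ≠ y → d v = c v := fun v h1 h2 => by simp [d, h1, h2]
    have hxw : ∀ w, G.Adj x w → d x ≠ d w := by
      intro w hw
      rcases (hNx w).1 hw with rfl | rfl | rfl
      · rwa [hdx, hdy]
      · rwa [hdx, hdo _ hxz.ne' hyz.ne']
      · rwa [hdx, hdo _ hxa.ne' hay]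
    have hyw : ∀ w, G.Adj y w → d y ≠ d w := by
      intro w hw
      rcases (hNy w).1 hw with rfl | rfl | rfl
      · rw [hdx, hdy]
        exact hpq.symm
      · rwa [hdy, hdo _ hxz.ne' hyz.ne']
      · rwa [hdy, hdo _ hbx hyb.ne']
    refine hG.1 ⟨d, fun u _ v _ huv => ?_⟩
    by_cases hux : u = x
    · exact hux ▸ hxw v (hux ▸ huv)
    by_cases huy : u = y
    · exact huy ▸ hyw v (huy ▸ huv)
    by_cases hvx : v = x
    · exact (hvx ▸ hxw u (hvx ▸ huv.symm)).symm
    by_cases hvy : v = y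
    · exact (hvy ▸ hyw u (hvy ▸ huv.symm)).symm
    rw [hdo u hux huy, hdo v hvx hvy]
    exact hc u (by simp [hux, huy]) v (by simp [hvx, hvy]) huv

/-- The two other neighbors of a vertex of degree three that has a neighbor of degree three
are adjacent. -/
theorem adj_of_adj_degree_three (hV : SmallerWitness V) (hG : G.IsVertexFourCritical)
    (hp : 6 ≤ G.potential Finset.univ) {x y u v : V}
    (hN : ∀ w, G.Adj x w ↔ w = y ∨ w = u ∨ w = v) (huv : u ≠ v) (huy : u ≠ y) (hvy : v ≠ y)
    (hy : (Finset.univ.filter (G.Adj y)).card = 3) : G.Adj u v := by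
  by_contra hnadj
  have hxy : G.Adj x y := (hN y).2 (by simp)
  have hxu : G.Adj x u := (hN u).2 (by simp)
  have hxv : G.Adj x v := (hN v).2 (by simp)
  obtain ⟨H, hHo, hHu⟩ := G.exists_merge u v
  obtain ⟨S, hST, hS, hpot⟩ := hV H ({x, y, v} : Finset V)ᶜ
    ((Finset.card_lt_iff_ne_univ _).2 (ne_univ_of_not_mem (x := x) (by simp))) (by
    rintro ⟨c, hc⟩
    let d : V → Fin 3 := fun w => if w = v then c u else c w
    have hdo : ∀ w, w ≠ v → d w = c w := fun w hw => by simp [d, hw]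
    have hdv : d v = d u := by simp [d]
    have hdu : ∀ w, w ≠ x → w ≠ y → w ≠ v → w ≠ u → (G.Adj u w ∨ G.Adj v w) →
        d u ≠ d w := by
      intro w hwx hwy hwv hwu h
      rw [hdo u huv, hdo w hwv]
      exact hc u (by simp [hxu.ne', huy, huv]) w (by simp [hwx, hwy, hwv]) ((hHu w hwu).2 h)
    have hd : ∀ a, a ≠ x → a ≠ y → ∀ b, b ≠ x → b ≠ y → G.Adj a b → d a ≠ d b := by
      intro a hax hay b hbx hby hab
      by_cases hau : a = u
      · subst hau
        exact hdu b hbx hby (fun h => hnadj (h ▸ hab)) hab.ne' (Or.inl hab)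
      by_cases hbu : b = u
      · subst hbu
        exact (hdu a hax hay (fun h => hnadj (h ▸ hab.symm)) hau (Or.inl hab.symm)).symm
      by_cases hav : a = v
      · subst hav
        rw [hdv]
        exact hdu b hbx hby hab.ne' hbu (Or.inr hab)
      by_cases hbv : b = v
      · subst hbv
        rw [hdv]
        exact (hdu a hax hay hav hau (Or.inr hab.symm)).symm
      rw [hdo a hav, hdo b hbv]
      exact hc a (by simp [hax, hay, hav]) b (by simp [hbx, hby, hbv])
        ((hHo a hau b hbu).2 hab)
    obtain ⟨i, hi⟩ := exists_color_not_mem (A := (Finset.univ.filter (G.Adj y)).erase x) (by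
      rw [Finset.card_erase_of_mem (by simp [hxy.symm]), hy]) d
    have hcol : ∀ p q : Fin 3, ∃ r, r ≠ p ∧ r ≠ q := by decide
    obtain ⟨j, hji, hju⟩ := hcol i (d u)
    let e : V → Fin 3 := fun w => if w = x then j else if w = y then i else d w
    have hex : e x = j := by simp [e]
    have hey : e y = i := by simp [e, hxy.ne']
    have heo : ∀ w, w ≠ x → w ≠ y → e w = d w := fun w h1 h2 => by simp [e, h1, h2]
    have hxw : ∀ w, G.Adj x w → e x ≠ e w := by
      intro w hw
      rcases (hN w).1 hw with rfl | rfl | rfl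
      · rwa [hex, hey]
      · rwa [hex, heo _ hxu.ne' huy]
      · rwa [hex, heo _ hxv.ne' hvy, hdv]
    have hyw : ∀ w, w ≠ x → G.Adj y w → e y ≠ e w := by
      intro w hwx hw
      rw [hey, heo w hwx hw.ne']
      exact (hi w (by simp [hwx, hw])).symm
    refine hG.1 ⟨e, fun a _ b _ hab => ?_⟩
    by_cases hax : a = x
    · exact hax ▸ hxw b (hax ▸ hab)
    by_cases hbx : b = x
    · exact (hbx ▸ hxw a (hbx ▸ hab.symm)).symm
    by_cases hay : a = y
    · exact hay ▸ hyw b hbx (hay ▸ hab)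
    by_cases hby : b = y
    · exact (hby ▸ hyw a hax (hby ▸ hab.symm)).symm
    rw [heo a hax hay, heo b hbx hby]
    exact hd a hax hay b hbx hby hab)
  have hxS : x ∉ S := fun h => by simpa using hST h
  have hyS : y ∉ S := fun h => by simpa using hST h
  have hvS : v ∉ S := fun h => by simpa using hST h
  have huS : u ∈ S := by
    by_contra huS
    refine hS ((hG.2 S (ne_univ_of_not_mem hxS)).congr fun a ha b hb hab => ?_)
    exact (hHo a (fun h => huS (h ▸ ha)) b (fun h => huS (h ▸ hb))).1 hab
  let S' := S.erase u
  have huS' : u ∉ S' := by simp [S']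
  have hS'S : S' ⊆ S := Finset.erase_subset _ _
  have hSu : S = {u} ∪ S' := by rw [← Finset.insert_eq]; exact (Finset.insert_erase huS).symm
  have hd0 : Disjoint {u} S' := by simpa using huS'
  have hd1 : Disjoint {v} S := by simpa using hvS
  have hd2 : Disjoint {x} ({v} ∪ S) := by simp [hxv.ne, hxS]
  have hcard := four_le_card_of_not_threeColorableOn hS
  have hlt := twelve_lt_potential hV hG hp (R := {x} ∪ ({v} ∪ S))
    (hcard.trans (Finset.card_le_card fun w hw => by simp [hw]))
    (ne_univ_of_not_mem (x := y) (by simp [hyS, hxy.ne', hvy.symm]))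
  have hself : ∀ (K : SimpleGraph V) (w : V), K.adjPairs {w} {w} = 0 := by
    simp [adjPairs]
  have h1 : H.adjPairs S' S' = G.adjPairs S' S' := adjPairs_congr fun a ha b hb =>
    hHo a (fun h => huS' (h ▸ ha)) b (fun h => huS' (h ▸ hb))
  have h2 : H.adjPairs {u} S' ≤ G.adjPairs {u} S' + G.adjPairs {v} S' := by
    rw [adjPairs_singleton_left, adjPairs_singleton_left, adjPairs_singleton_left]
    have : S'.filter (H.Adj u) ⊆ S'.filter (G.Adj u) ∪ S'.filter (G.Adj v) := by
      intro w hw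
      obtain ⟨hw, huw⟩ := Finset.mem_filter.1 hw
      have := (hHu w (fun h => huS' (h ▸ hw))).1 huw
      simpa [hw] using this
    exact_mod_cast (Finset.card_le_card this).trans (Finset.card_union_le _ _)
  have h3 : G.adjPairs {v} S' ≤ G.adjPairs {v} S := adjPairs_mono_right hS'S
  have h4 : 1 ≤ G.adjPairs {x} {v} := one_le_adjPairs (by simp) (by simp) hxv
  have h5 : 1 ≤ G.adjPairs {x} S := one_le_adjPairs (by simp) huS hxu
  have h6 : H.adjPairs S S = 2 * H.adjPairs {u} S' + G.adjPairs S' S' := by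
    rw [hSu, adjPairs_union_self hd0, hself, h1, zero_add]
  have h7 : G.adjPairs S S = 2 * G.adjPairs {u} S' + G.adjPairs S' S' := by
    rw [hSu, adjPairs_union_self hd0, hself, zero_add]
  unfold potential at hpot hlt
  rw [adjPairs_union_self hd2, adjPairs_union_right hd1, adjPairs_union_self hd1,
    Finset.card_union_of_disjoint hd2, Finset.card_union_of_disjoint hd1, hself, hself] at hlt
  simp only [Finset.card_singleton] at hlt
  push_cast at hlt
  linarith

/-- A vertex of degree three has at most one neighbor of degree three. -/
theorem eq_of_adj_degree_three (hV : SmallerWitness V) (hG : G.IsVertexFourCritical)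
    (hp : 6 ≤ G.potential Finset.univ) {x y z : V} (hxy : G.Adj x y) (hxz : G.Adj x z)
    (hx : (Finset.univ.filter (G.Adj x)).card = 3)
    (hy : (Finset.univ.filter (G.Adj y)).card = 3)
    (hz : (Finset.univ.filter (G.Adj z)).card = 3) : y = z := by
  by_contra hyz
  have : (((Finset.univ.filter (G.Adj x)).erase y).erase z).card = 1 := by
    rw [Finset.card_erase_of_mem (by simp [hxz, Ne.symm hyz]),
      Finset.card_erase_of_mem (by simp [hxy]), hx]
  obtain ⟨v, hv⟩ := Finset.card_eq_one.1 this
  have hw : ∀ w, w ≠ z ∧ w ≠ y ∧ G.Adj x w ↔ w = v := fun w => by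
    simpa using Finset.ext_iff.1 hv w
  obtain ⟨hvz, hvy, hxv⟩ := (hw v).2 rfl
  have hN : ∀ w, G.Adj x w ↔ w = y ∨ w = z ∨ w = v := by
    refine fun w => ⟨fun h => ?_, ?_⟩
    · have := hw w
      tauto
    · rintro (rfl | rfl | rfl)
      exacts [hxy, hxz, hxv]
  have hzv := adj_of_adj_degree_three hV hG hp hN hvz.symm (Ne.symm hyz) hvy hy
  exact false_of_triangle hV hG hp hxz hxv hzv hx hz

theorem potential_univ_le_of_smallerWitness (hV : SmallerWitness V)
    (hG : G.IsVertexFourCritical) : G.potential Finset.univ ≤ 4 := by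
  by_contra! h4
  have hp : 6 ≤ G.potential Finset.univ := by
    obtain ⟨k, hk⟩ := G.even_potential Finset.univ
    omega
  let D : Finset V := Finset.univ.filter fun v => (Finset.univ.filter (G.Adj v)).card = 3
  have hdisj : Disjoint D Dᶜ := disjoint_compl_right
  have hu : D ∪ Dᶜ = Finset.univ := Finset.union_compl D
  have h1 : G.adjPairs D Finset.univ = 3 * D.card := by
    rw [adjPairs_eq_sum_card, Finset.sum_congr rfl fun v hv => by
      rw [(Finset.mem_filter.1 hv).2]]
    simp [mul_comm]
  have h2 : 4 * (Dᶜ.card : ℤ) ≤ G.adjPairs Dᶜ Finset.univ := by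
    rw [adjPairs_eq_sum_card]
    have := Finset.card_nsmul_le_sum Dᶜ
      (fun v => ((Finset.univ.filter (G.Adj v)).card : ℤ)) 4 fun v hv => by
        have h3 := hG.three_le_degree v
        have h3' : (Finset.univ.filter (G.Adj v)).card ≠ 3 := by simpa [D] using hv
        have : 4 ≤ (Finset.univ.filter (G.Adj v)).card := by omega
        exact_mod_cast this
    simpa [mul_comm] using this
  have h3 : G.adjPairs D D ≤ D.card := by
    rw [adjPairs_eq_sum_card]
    have := Finset.sum_le_card_nsmul D (fun v => ((D.filter (G.Adj v)).card : ℤ)) 1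
      fun x hx => by
        have : (D.filter (G.Adj x)).card ≤ 1 := by
          rw [Finset.card_le_one]
          intro y hy z hz
          simp only [D, Finset.mem_filter, Finset.mem_univ, true_and] at hx hy hz
          exact eq_of_adj_degree_three hV hG hp hy.2 hz.2 hx hy.1 hz.1
        exact_mod_cast this
    simpa using this
  have h5 : G.adjPairs D Finset.univ = G.adjPairs D D + G.adjPairs D Dᶜ := by
    rw [← adjPairs_union_right hdisj, hu]
  have h6 : G.adjPairs D Dᶜ ≤ G.adjPairs Dᶜ Finset.univ := by
    rw [adjPairs_comm]
    exact adjPairs_mono_right (Finset.subset_univ _)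
  have h7 : G.adjPairs Finset.univ Finset.univ =
      G.adjPairs D Finset.univ + G.adjPairs Dᶜ Finset.univ := by
    rw [← adjPairs_union_left hdisj, hu]
  have h8 : ((Finset.univ : Finset V).card : ℤ) = D.card + Dᶜ.card := by
    rw [← hu, Finset.card_union_of_disjoint hdisj]
    push_cast
    rfl
  unfold potential at hp
  rw [h8] at hp
  linarith

theorem IsVertexFourCritical.potential_univ_le (hG : G.IsVertexFourCritical) :
    G.potential Finset.univ ≤ 4 := by
  induction hn : Fintype.card V using Nat.strong_induction_on generalizing V with
  | _ n ih =>
    refine potential_univ_le_of_smallerWitness (fun H T hT hcol => ?_) hG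
    obtain ⟨S, hS, hmin⟩ := Finset.exists_min_image
      (T.powerset.filter fun S => ¬ H.ThreeColorableOn S) Finset.card ⟨T, by simp [hcol]⟩
    simp only [Finset.mem_filter, Finset.mem_powerset] at hS hmin
    refine ⟨S, hS.1, hS.2, ?_⟩
    let K : SimpleGraph S := H.comap Subtype.val
    have hK : K.IsVertexFourCritical := by
      constructor
      · rintro ⟨c, hc⟩
        refine hS.2 ⟨fun v => if hv : v ∈ S then c ⟨v, hv⟩ else 0, fun u hu v hv huv => ?_⟩
        simpa [hu, hv] using hc ⟨u, hu⟩ (by simp) ⟨v, hv⟩ (by simp) huv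
      · intro Q hQ
        let Q' : Finset V := Q.map (Function.Embedding.subtype _)
        have hlt : Q'.card < S.card := by
          simpa [Q'] using (Finset.card_lt_iff_ne_univ Q).2 hQ
        have hQ' : H.ThreeColorableOn Q' := by
          by_contra h
          refine hlt.not_ge (hmin Q' ⟨fun v hv => hS.1 ?_, h⟩)
          obtain ⟨w, -, rfl⟩ := Finset.mem_map.1 hv
          exact w.2
        obtain ⟨c, hc⟩ := hQ'
        exact ⟨fun v => c v, fun u hu v hv huv =>
          hc u (Finset.mem_map_of_mem _ hu) v (Finset.mem_map_of_mem _ hv) huv⟩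
    have hcard : Fintype.card S < n := by
      have := Finset.card_le_card hS.1
      simp only [Fintype.card_coe]
      omega
    have := ih _ hcard hK rfl
    have hpairs : K.adjPairs Finset.univ Finset.univ = H.adjPairs S S := by
      unfold adjPairs
      rw [← Finset.sum_coe_sort S]
      refine Finset.sum_congr rfl fun u _ => ?_
      rw [← Finset.sum_coe_sort S]
      rfl
    unfold potential at this ⊢
    rw [hpairs] at this
    simpa using this

theorem IsFourCritical.isVertexFourCritical (hG : G.IsFourCritical) :
    G.IsVertexFourCritical := by
  constructor
  · rintro ⟨c, hc⟩
    have hcol : G.Colorable 3 :=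
      ⟨Coloring.mk c fun {u v} huv => hc u (by simp) v (by simp) huv⟩
    have := chromaticNumber_le_iff_colorable.2 hcol
    rw [hG.1] at this
    exact absurd this (by decide)
  · intro S hS
    obtain ⟨c⟩ := hG.2 ((⊤ : G.Subgraph).induce S) fun h => hS <| by
      have := congrArg Subgraph.verts h
      simpa using this
    refine ⟨fun v => if hv : v ∈ S then c ⟨v, hv⟩ else 0, fun u hu v hv huv => ?_⟩
    have : ((⊤ : G.Subgraph).induce (S : Set V)).coe.Adj ⟨u, hu⟩ ⟨v, hv⟩ := by
      simpa [hu, hv] using huv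
    simpa [hu, hv] using c.valid this

theorem adjPairs_univ_univ (G : SimpleGraph V) :
    G.adjPairs Finset.univ Finset.univ = 2 * G.edgeSet.ncard := by
  have h := G.sum_degrees_eq_twice_card_edges
  rw [adjPairs_eq_sum_card, Set.ncard_eq_toFinset_card', ← edgeFinset]
  simp only [← neighborFinset_eq_filter, card_neighborFinset_eq_degree]
  exact_mod_cast h

end

end SimpleGraph

/-- Kostochka–Yancey: every 4-critical graph on `n` vertices has at least `(5n-2)/3` edges. -/
theorem four_critical_edge_bound [Fintype V] (G : SimpleGraph V)
    (hG : G.IsFourCritical) :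
    (5 * (Fintype.card V : ℚ) - 2) / 3 ≤ (G.edgeSet.ncard : ℚ) := by
  have h := hG.isVertexFourCritical.potential_univ_le
  rw [SimpleGraph.potential, SimpleGraph.adjPairs_univ_univ, Finset.card_univ] at h
  have h' : (10 * (Fintype.card V : ℚ) - 3 * (2 * G.edgeSet.ncard)) ≤ 4 := by exact_mod_cast h
  linarith
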